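/- Let Γ = (G, I, O, λ) be a labelled open graph and S ⊆ V∖O. If the sets p̂, q̂ ⊆ V∖I are both focussed over S, then their symmetric difference p̂ Δ q̂ is also focussed over S. -/

import Mathlib

open scoped symmDiff

inductive MeasLabel : Type
  | XY | XZ | YZ | X | Y | Z
deriving DecidableEq

/-- A labelled open graph: a finite simple graph with input and output sets and a
measurement labelling (only its values on non-outputs are ever used). -/
structure LOG (V : Type) [Fintype V] where
  G : SimpleGraph V
  I : Set V
  O : Set V
  lam : V → MeasLabel

namespace LOG

variable {V : Type} [Fintype V]

/-- The odd neighbourhood of `A`: vertices with an odd number of neighbours in `A`. -/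
def odd (G : SimpleGraph V) (A : Set V) : Set V :=
  {w | Odd ((G.neighborSet w ∩ A).ncard)}

/-- `v` is a measured (non-output) vertex whose label lies in `s`.  (The labelling of a
labelled open graph is only defined on non-outputs.) -/
def labIn (Γ : LOG V) (v : V) (s : Set MeasLabel) : Prop :=
  v ∉ Γ.O ∧ Γ.lam v ∈ s

/-- The Pauli flow conditions for a map `p` and a strict partial order `prec` (`≺`). -/
structure IsPauliFlow (Γ : LOG V) (p : V → Set V) (prec : V → V → Prop) : Prop where
  irrefl : ∀ a, ¬ prec a a
  trans : ∀ a b c, prec a b → prec b c → prec a c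
  psub : ∀ u, u ∉ Γ.O → ∀ v ∈ p u, v ∉ Γ.I
  pf1 : ∀ u, u ∉ Γ.O → ∀ v ∈ p u, u ≠ v →
    ¬ Γ.labIn v {MeasLabel.X, MeasLabel.Y} → prec u v
  pf2 : ∀ u, u ∉ Γ.O → ∀ v ∈ odd Γ.G (p u), u ≠ v →
    ¬ Γ.labIn v {MeasLabel.Y, MeasLabel.Z} → prec u v
  pf3 : ∀ u, u ∉ Γ.O → ∀ v, ¬ prec u v → u ≠ v →
    Γ.labIn v {MeasLabel.Y} → (v ∈ p u ↔ v ∈ odd Γ.G (p u))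
  pf4 : ∀ u, u ∉ Γ.O → Γ.lam u = MeasLabel.XY → u ∉ p u ∧ u ∈ odd Γ.G (p u)
  pf5 : ∀ u, u ∉ Γ.O → Γ.lam u = MeasLabel.XZ → u ∈ p u ∧ u ∈ odd Γ.G (p u)
  pf6 : ∀ u, u ∉ Γ.O → Γ.lam u = MeasLabel.YZ → u ∈ p u ∧ u ∉ odd Γ.G (p u)
  pf7 : ∀ u, u ∉ Γ.O → Γ.lam u = MeasLabel.X → u ∈ odd Γ.G (p u)
  pf8 : ∀ u, u ∉ Γ.O → Γ.lam u = MeasLabel.Z → u ∈ p u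
  pf9 : ∀ u, u ∉ Γ.O → Γ.lam u = MeasLabel.Y →
    ((u ∈ p u ∧ u ∉ odd Γ.G (p u)) ∨ (u ∉ p u ∧ u ∈ odd Γ.G (p u)))

/-- `phat` is focussed over `S`. -/
def FocussedOver (Γ : LOG V) (phat S : Set V) : Prop :=
  (∀ w ∈ S ∩ phat, Γ.lam w ∈ ({MeasLabel.XY, MeasLabel.X, MeasLabel.Y} : Set MeasLabel)) ∧
  (∀ w ∈ S ∩ odd Γ.G phat,
    Γ.lam w ∈ ({MeasLabel.XZ, MeasLabel.YZ, MeasLabel.Y, MeasLabel.Z} : Set MeasLabel)) ∧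
  (∀ w ∈ S, Γ.lam w = MeasLabel.Y → (w ∈ phat ↔ w ∈ odd Γ.G phat))

/-- A focussed set for `Γ`: a subset of the non-inputs that is focussed over all
non-outputs. -/
def IsFocussedSet (Γ : LOG V) (phat : Set V) : Prop :=
  (∀ v ∈ phat, v ∉ Γ.I) ∧ FocussedOver Γ phat {v | v ∉ Γ.O}

/-- A Pauli flow map `p` is focussed if each `p v` is focussed over the measured
vertices other than `v`. -/
def IsFocussed (Γ : LOG V) (p : V → Set V) : Prop :=
  ∀ v, v ∉ Γ.O → FocussedOver Γ (p v) ({w | w ∉ Γ.O} \ {v})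

/-- `Vcum prec k` is `V_{∪k}^≺`, the union of the layers up to depth `k`. -/
def Vcum (prec : V → V → Prop) : ℕ → Set V
  | 0 => {v | ∀ w, ¬ prec v w}
  | k + 1 => Vcum prec k ∪ {v | v ∉ Vcum prec k ∧ ∀ w, w ∉ Vcum prec k → ¬ prec v w}

/-- `Vlayer prec k` is `V_k^≺`, the `≺`-maximal elements among the vertices not of
smaller depth. -/
def Vlayer (prec : V → V → Prop) : ℕ → Set V
  | 0 => {v | ∀ w, ¬ prec v w}
  | k + 1 => {v | v ∉ Vcum prec k ∧ ∀ w, w ∉ Vcum prec k → ¬ prec v w}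

/-- `prec` is more delayed than `prec'`. -/
def MoreDelayed (prec prec' : V → V → Prop) : Prop :=
  (∀ k, (Vcum prec' k).ncard ≤ (Vcum prec k).ncard) ∧
  ∃ k, (Vcum prec' k).ncard < (Vcum prec k).ncard

/-- A maximally delayed Pauli flow: no Pauli flow for the same labelled open graph is
more delayed. -/
def IsMaxDelayed (Γ : LOG V) (p : V → Set V) (prec : V → V → Prop) : Prop :=
  IsPauliFlow Γ p prec ∧
  ∀ q prec', IsPauliFlow Γ q prec' → ¬ MoreDelayed prec' prec

/-- `Λ_u^P`: the measured vertices other than `u` whose label is `P`. -/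
def LamP (Γ : LOG V) (u : V) (P : MeasLabel) : Set V :=
  {v | v ∉ Γ.O ∧ v ≠ u ∧ Γ.lam v = P}

/-- `V_{k+1}^{≺,XY}` where `A = V_{∪k}^≺`. -/
def VXY (Γ : LOG V) (A : Set V) : Set V :=
  {u | u ∉ Γ.O ∧ Γ.lam u ∈ ({MeasLabel.XY, MeasLabel.X, MeasLabel.Y} : Set MeasLabel) ∧
    ∃ K, K ⊆ (A ∪ LamP Γ u MeasLabel.X ∪ LamP Γ u MeasLabel.Y) ∩ {v | v ∉ Γ.I} ∧
      (K ∩ LamP Γ u MeasLabel.Y) \ A = (odd Γ.G K ∩ LamP Γ u MeasLabel.Y) \ A ∧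
      odd Γ.G K \ (A ∪ LamP Γ u MeasLabel.Y ∪ LamP Γ u MeasLabel.Z) = {u}}

/-- `V_{k+1}^{≺,XZ}` where `A = V_{∪k}^≺`. -/
def VXZ (Γ : LOG V) (A : Set V) : Set V :=
  {u | u ∉ Γ.O ∧ Γ.lam u ∈ ({MeasLabel.XZ, MeasLabel.X, MeasLabel.Z} : Set MeasLabel) ∧
    ∃ K, K ⊆ (A ∪ LamP Γ u MeasLabel.X ∪ LamP Γ u MeasLabel.Y) ∩ {v | v ∉ Γ.I} ∧
      (K ∩ LamP Γ u MeasLabel.Y) \ A = (odd Γ.G (K ∪ {u}) ∩ LamP Γ u MeasLabel.Y) \ A ∧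
      odd Γ.G (K ∪ {u}) \ (A ∪ LamP Γ u MeasLabel.Y ∪ LamP Γ u MeasLabel.Z) = {u}}

/-- `V_{k+1}^{≺,YZ}` where `A = V_{∪k}^≺`. -/
def VYZ (Γ : LOG V) (A : Set V) : Set V :=
  {u | u ∉ Γ.O ∧ Γ.lam u ∈ ({MeasLabel.YZ, MeasLabel.Y, MeasLabel.Z} : Set MeasLabel) ∧
    ∃ K, K ⊆ (A ∪ LamP Γ u MeasLabel.X ∪ LamP Γ u MeasLabel.Y) ∩ {v | v ∉ Γ.I} ∧
      (K ∩ LamP Γ u MeasLabel.Y) \ A = (odd Γ.G (K ∪ {u}) ∩ LamP Γ u MeasLabel.Y) \ A ∧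
      odd Γ.G (K ∪ {u}) \ (A ∪ LamP Γ u MeasLabel.Y ∪ LamP Γ u MeasLabel.Z) = ∅}

end LOG


theorem ncard_symmDiff_parity {V : Type} [Finite V] (A B : Set V) :
    Odd ((A ∆ B).ncard) ↔ ¬ (Odd A.ncard ↔ Odd B.ncard) := by
  have h1 : (A ∆ B).ncard = (A \ B).ncard + (B \ A).ncard := by
    rw [Set.symmDiff_def]
    exact Set.ncard_union_eq disjoint_sdiff_sdiff (Set.toFinite _) (Set.toFinite _)
  have h2 := Set.ncard_inter_add_ncard_diff_eq_ncard A B (Set.toFinite _)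
  have h3 := Set.ncard_inter_add_ncard_diff_eq_ncard B A (Set.toFinite _)
  rw [Set.inter_comm] at h3
  simp only [Nat.odd_iff]
  omega

theorem mem_odd_symmDiff {V : Type} [Fintype V] (G : SimpleGraph V) (A B : Set V) (w : V) :
    w ∈ LOG.odd G (A ∆ B) ↔ ¬ (w ∈ LOG.odd G A ↔ w ∈ LOG.odd G B) := by
  simp only [LOG.odd, Set.mem_setOf_eq]
  rw [← ncard_symmDiff_parity, Set.inter_symmDiff_distrib_left]

open LOG in
/-- the symmetric difference of two sets focussed over `S` is focussed
over `S`. -/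
theorem focussedOver_symmDiff {V : Type} [Fintype V] (Γ : LOG V)
    (S : Set V) (hS : ∀ w ∈ S, w ∉ Γ.O)
    (phat qhat : Set V)
    (hpsub : ∀ w ∈ phat, w ∉ Γ.I) (hqsub : ∀ w ∈ qhat, w ∉ Γ.I)
    (hp : FocussedOver Γ phat S) (hq : FocussedOver Γ qhat S) :
    FocussedOver Γ (phat ∆ qhat) S := by
  obtain ⟨p1, p2, p3⟩ := hp
  obtain ⟨q1, q2, q3⟩ := hq
  refine ⟨?_, ?_, ?_⟩
  · rintro w ⟨hw, h | h⟩
    · exact p1 w ⟨hw, h.1⟩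
    · exact q1 w ⟨hw, h.1⟩
  · rintro w ⟨hw, h⟩
    rw [mem_odd_symmDiff] at h
    by_cases hpw : w ∈ odd Γ.G phat
    · exact p2 w ⟨hw, hpw⟩
    · exact q2 w ⟨hw, by tauto⟩
  · intro w hw hl
    have a := p3 w hw hl
    have b := q3 w hw hl
    rw [mem_odd_symmDiff, Set.mem_symmDiff]
    tauto
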